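/- Let B ≥ 2 be an integer and n ≥ 1. If h : Δ_n → ℝ is Borel measurable and barycentrically B-almost convex, then for every (x_0,…,x_n) ∈ Δ_n, h(x_0,…,x_n) ≤ ∑_{k=0}^n H_B(x_k) + ∑_{k=0}^n x_k·h(e_k). -/

import Mathlib

open scoped BigOperators

/-- `H_B(x) = ∑_{k=0}^∞ {B^k x}/B^k` where `{y}` is the fractional part. -/
noncomputable def HB (B : ℕ) (x : ℝ) : ℝ :=
  ∑' k : ℕ, Int.fract ((B : ℝ) ^ k * x) / (B : ℝ) ^ k

def ACx {ι : Type} [Fintype ι] (B : ℕ) (h : (ι → ℝ) → ℝ) : Prop :=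
  ∀ y : Fin B → (ι → ℝ), (∀ i, y i ∈ stdSimplex ℝ ι) →
      h (fun j => (∑ i, y i j) / (B : ℝ)) ≤ 1 + (1 / (B : ℝ)) * ∑ i, h (y i)

lemma fract_shift (B d : ℕ) (z : ℝ) :
    Int.fract ((B : ℝ) ^ d * Int.fract ((B : ℝ) * z)) = Int.fract ((B : ℝ) ^ (d + 1) * z) := by
  rw [Int.fract_eq_fract]
  refine ⟨-((B : ℤ) ^ d * ⌊(B : ℝ) * z⌋), ?_⟩
  rw [Int.fract]
  push_cast
  ring

lemma tree {ι : Type} [Fintype ι] [DecidableEq ι] (B : ℕ) (hB : 2 ≤ B) (h : (ι → ℝ) → ℝ)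
    (hac : ACx B h) (hv : ∀ k, h (Pi.single k 1) ≤ 0) (C : ℝ)
    (hC : ∀ x ∈ stdSimplex ℝ ι, h x ≤ C) (N : ℕ) :
    ∀ (m : ℕ) (z : ι → ℝ), (∀ k, 0 ≤ z k) → (∀ k, z k < 1) → ∑ k, z k = m →
      ∃ y : Fin m → (ι → ℝ), (∀ i, y i ∈ stdSimplex ℝ ι) ∧ (∀ k, ∑ i, y i k = z k) ∧
        ∑ i, h (y i) ≤ (∑ d ∈ Finset.range N, ∑ k, Int.fract ((B : ℝ) ^ d * z k) / (B : ℝ) ^ d)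
          + C * (∑ k, Int.fract ((B : ℝ) ^ N * z k)) / (B : ℝ) ^ N := by
  have hB0 : (0 : ℝ) < B := by positivity
  induction N with
  | zero =>
    intro m z h0 h1 hs
    have hfr : ∀ k, Int.fract (z k) = z k := fun k => Int.fract_eq_self.2 ⟨h0 k, h1 k⟩
    have hmem : ∀ i : Fin m, (fun k => z k / m) ∈ stdSimplex ℝ ι := by
      intro i
      have hm : (0 : ℝ) < m := by exact_mod_cast (Nat.pos_of_ne_zero (by rintro rfl; exact i.elim0))
      refine ⟨fun k => div_nonneg (h0 k) hm.le, ?_⟩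
      rw [← Finset.sum_div, hs, div_self hm.ne']
    refine ⟨fun _ k => z k / m, hmem, ?_, ?_⟩
    · intro k
      rcases Nat.eq_zero_or_pos m with rfl | hm
      · have : ∑ k, z k = 0 := by simpa using hs
        have := (Finset.sum_eq_zero_iff_of_nonneg (fun k _ => h0 k)).1 this k (Finset.mem_univ _)
        simp [this]
      · have : (m : ℝ) ≠ 0 := by positivity
        simp
        field_simp
    · simp only [Finset.range_zero, Finset.sum_empty, pow_zero, one_mul, div_one, hfr, hs, zero_add]
      calc _ ≤ ∑ i : Fin m, C := Finset.sum_le_sum fun i _ => hC _ (hmem i)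
        _ = C * m := by simp [mul_comm]
  | succ N ih =>
    intro m z h0 h1 hs
    have hfr : ∀ k, Int.fract (z k) = z k := fun k => Int.fract_eq_self.2 ⟨h0 k, h1 k⟩
    set d : ι → ℕ := fun k => ⌊(B : ℝ) * z k⌋₊ with hd
    have hdf : ∀ k, Int.fract ((B : ℝ) * z k) = B * z k - d k := by
      intro k
      have := natCast_floor_eq_intCast_floor (R := ℝ) (mul_nonneg hB0.le (h0 k))
      rw [Int.fract, hd, this]
    have hsum : ∑ k, Int.fract ((B : ℝ) * z k) = (B * m : ℕ) - (∑ k, d k : ℕ) := by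
      simp only [hdf, Finset.sum_sub_distrib, ← Finset.mul_sum, hs]
      push_cast; rfl
    have hle : ∑ k, d k ≤ B * m := by
      have : 0 ≤ ∑ k, Int.fract ((B : ℝ) * z k) := Finset.sum_nonneg fun k _ => Int.fract_nonneg _
      rw [hsum] at this
      exact_mod_cast sub_nonneg.1 this
    obtain ⟨y, hy, hys, hyb⟩ := ih (B * m - ∑ k, d k) (fun k => Int.fract ((B : ℝ) * z k))
      (fun k => Int.fract_nonneg _) (fun k => Int.fract_lt_one _) (by rw [hsum, Nat.cast_sub hle])
    have hcard : Fintype.card (Fin m × Fin B) =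
        Fintype.card (Fin (B * m - ∑ k, d k) ⊕ (Σ k, Fin (d k))) := by
      simp [Fintype.card_sigma, Nat.sub_add_cancel hle, mul_comm]
    let e := Fintype.equivOfCardEq hcard
    let Y : (Fin (B * m - ∑ k, d k) ⊕ (Σ k, Fin (d k))) → ι → ℝ :=
      Sum.elim y (fun p => Pi.single p.1 1)
    have hYm : ∀ q, Y q ∈ stdSimplex ℝ ι := by
      rintro (q | q)
      · exact hy q
      · exact single_mem_stdSimplex ℝ q.1
    have hYs : ∀ f : (ι → ℝ) → ℝ, ∑ i : Fin m, ∑ b : Fin B, f (Y (e (i, b))) =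
        ∑ i, f (y i) + ∑ k, d k * f (Pi.single k 1) := by
      intro f
      rw [← Fintype.sum_prod_type' (f := fun i b => f (Y (e (i, b))))]
      simp only [Prod.mk.eta]
      rw [Equiv.sum_comp e (fun q => f (Y q)), Fintype.sum_sum_type, Fintype.sum_sigma]
      simp [Y]
    refine ⟨fun i j => (∑ b, Y (e (i, b)) j) / B, ?_, ?_, ?_⟩
    · intro i
      refine ⟨fun k => div_nonneg (Finset.sum_nonneg fun b _ => (hYm _).1 k) hB0.le, ?_⟩
      rw [← Finset.sum_div, Finset.sum_comm, Finset.sum_congr rfl (fun b _ => (hYm (e (i, b))).2)]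
      simp [hB0.ne']
    · intro k
      rw [← Finset.sum_div, hYs (fun v => v k), hys k, hdf]
      simp [Pi.single_apply]
      field_simp
    · have h2 : ∑ i : Fin m, h (fun j => (∑ b, Y (e (i, b)) j) / B) ≤
          ∑ i : Fin m, (1 + (1 / (B : ℝ)) * ∑ b, h (Y (e (i, b)))) :=
        Finset.sum_le_sum fun i _ => hac _ (fun b => hYm _)
      refine h2.trans ?_
      rw [Finset.sum_add_distrib, ← Finset.mul_sum, hYs h]
      have h3 : ∑ k, d k * h (Pi.single k 1) ≤ 0 :=
        Finset.sum_nonpos fun k _ => mul_nonpos_of_nonneg_of_nonpos (by positivity) (hv k)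
      simp only [fract_shift] at hyb
      rw [Finset.sum_range_succ']
      simp only [pow_zero, one_mul, div_one, hfr, hs]
      have h4 : (∑ d ∈ Finset.range N, ∑ k, Int.fract ((B : ℝ) ^ (d + 1) * z k) / (B : ℝ) ^ (d + 1))
          = (1 / (B : ℝ)) * ∑ d ∈ Finset.range N, ∑ k, Int.fract ((B : ℝ) ^ (d + 1) * z k) / (B : ℝ) ^ d := by
        simp only [Finset.mul_sum]
        refine Finset.sum_congr rfl fun d _ => Finset.sum_congr rfl fun k _ => ?_
        rw [pow_succ (B : ℝ) d, one_div_mul_eq_div, div_div]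
      have h5 : C * (∑ k, Int.fract ((B : ℝ) ^ (N + 1) * z k)) / (B : ℝ) ^ (N + 1) =
         (1 / (B : ℝ)) * (C * (∑ k, Int.fract ((B : ℝ) ^ (N + 1) * z k)) / (B : ℝ) ^ N) := by
        rw [pow_succ (B : ℝ) N, one_div_mul_eq_div, div_div]
      rw [h4, h5]
      have h6 := mul_le_mul_of_nonneg_left (add_le_add hyb h3) (one_div_pos.2 hB0).le
      simp only [Finset.sum_const, Finset.card_univ, Fintype.card_fin, nsmul_eq_mul, mul_one] at *
      linarith

lemma HB_term (B : ℕ) (hB : 2 ≤ B) (x : ℝ) (k : ℕ) :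
    0 ≤ Int.fract ((B : ℝ) ^ k * x) / (B : ℝ) ^ k ∧
    Int.fract ((B : ℝ) ^ k * x) / (B : ℝ) ^ k ≤ (1 / 2) ^ k := by
  have hB' : (2 : ℝ) ≤ B := by exact_mod_cast hB
  refine ⟨div_nonneg (Int.fract_nonneg _) (by positivity), ?_⟩
  rw [one_div, inv_pow, ← one_div]
  exact div_le_div₀ zero_le_one (Int.fract_lt_one _).le (by positivity)
    (pow_le_pow_left₀ (by norm_num) hB' _)

lemma HB_summable (B : ℕ) (hB : 2 ≤ B) (x : ℝ) :
    Summable fun k : ℕ => Int.fract ((B : ℝ) ^ k * x) / (B : ℝ) ^ k :=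
  Summable.of_nonneg_of_le (fun k => (HB_term B hB x k).1) (fun k => (HB_term B hB x k).2)
    summable_geometric_two

lemma HB_nonneg (B : ℕ) (hB : 2 ≤ B) (x : ℝ) : 0 ≤ HB B x :=
  tsum_nonneg fun k => (HB_term B hB x k).1

lemma HB_le (B : ℕ) (hB : 2 ≤ B) (x : ℝ) : HB B x ≤ 2 := by
  rw [← tsum_geometric_two]
  exact (HB_summable B hB x).tsum_le_tsum (fun k => (HB_term B hB x k).2) summable_geometric_two

lemma eq_single {ι : Type} [Fintype ι] [DecidableEq ι] (x : ι → ℝ) (hx : x ∈ stdSimplex ℝ ι)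
    (k : ι) (hk : 1 ≤ x k) : x = Pi.single k 1 := by
  have h2 := hx.2
  rw [← Finset.add_sum_erase _ _ (Finset.mem_univ k)] at h2
  have h3 : 0 ≤ ∑ i ∈ Finset.univ.erase k, x i := Finset.sum_nonneg fun i _ => hx.1 i
  have h4 : ∑ i ∈ Finset.univ.erase k, x i = 0 := by linarith
  have h5 := (Finset.sum_eq_zero_iff_of_nonneg (fun i _ => hx.1 i)).1 h4
  ext j
  by_cases hj : j = k
  · subst hj; simp; linarith
  · simp [hj]; exact h5 j (by simp [hj])

lemma tree_bound {ι : Type} [Fintype ι] [DecidableEq ι] (B : ℕ) (hB : 2 ≤ B) (h : (ι → ℝ) → ℝ)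
    (hac : ACx B h) (hv : ∀ k, h (Pi.single k 1) ≤ 0) (C : ℝ)
    (hC : ∀ x ∈ stdSimplex ℝ ι, h x ≤ C) (x : ι → ℝ) (hx : x ∈ stdSimplex ℝ ι) :
    h x ≤ ∑ k, HB B (x k) := by
  have hB' : (2 : ℝ) ≤ B := by exact_mod_cast hB
  by_cases h1 : ∀ k, x k < 1
  · have key : ∀ N : ℕ, h x ≤ ∑ k, HB B (x k) + (|C| * Fintype.card ι) * (1 / 2) ^ N := by
      intro N
      obtain ⟨y, hy, hys, hyb⟩ := tree B hB h hac hv C hC N 1 x hx.1 h1 (by simpa using hx.2)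
      have hyx : y 0 = x := by
        ext k; simpa using hys k
      simp only [Finset.univ_unique, Fin.default_eq_zero, Finset.sum_singleton, Fin.isValue, hyx] at hyb
      refine hyb.trans (add_le_add ?_ ?_)
      · rw [Finset.sum_comm]
        exact Finset.sum_le_sum fun k _ =>
          (HB_summable B hB (x k)).sum_le_tsum _ (fun d _ => (HB_term B hB _ d).1)
      · rw [mul_div_assoc, Finset.sum_div]
        have hn : 0 ≤ ∑ k, Int.fract ((B : ℝ) ^ N * x k) / (B : ℝ) ^ N :=
          Finset.sum_nonneg fun k _ => (HB_term B hB _ N).1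
        have hl : ∑ k, Int.fract ((B : ℝ) ^ N * x k) / (B : ℝ) ^ N ≤ ∑ k : ι, (1 / 2 : ℝ) ^ N :=
          Finset.sum_le_sum fun k _ => (HB_term B hB _ N).2
        rw [Finset.sum_const, Finset.card_univ, nsmul_eq_mul] at hl
        rw [mul_assoc]
        exact mul_le_mul (le_abs_self C) hl hn (abs_nonneg _)
    have ht : Filter.Tendsto (fun N : ℕ => ∑ k, HB B (x k) + (|C| * Fintype.card ι) * (1 / 2 : ℝ) ^ N)
        Filter.atTop (nhds (∑ k, HB B (x k) + (|C| * Fintype.card ι) * 0)) :=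
      ((tendsto_pow_atTop_nhds_zero_of_lt_one (by norm_num) (by norm_num)).const_mul _).const_add _
    simpa using ge_of_tendsto' ht key
  · push Not at h1
    obtain ⟨k, hk⟩ := h1
    have := hv k
    rw [← eq_single x hx k hk] at this
    exact this.trans (Finset.sum_nonneg fun k _ => HB_nonneg B hB _)

def ACs (B : ℕ) (g : ℝ → ℝ) : Prop :=
  ∀ y : Fin B → ℝ, (∀ i, y i ∈ Set.Icc (0 : ℝ) 1) →
      g ((∑ i, y i) / (B : ℝ)) ≤ 1 + (1 / (B : ℝ)) * ∑ i, g (y i)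

/-- Two-valued form of almost convexity. -/
lemma ACs_two (B : ℕ) (hB : 2 ≤ B) (g : ℝ → ℝ) (hg : ACs B g) (u v : ℝ)
    (hu : u ∈ Set.Icc (0 : ℝ) 1) (hv : v ∈ Set.Icc (0 : ℝ) 1) :
    g ((u + (B - 1) * v) / B) ≤ 1 + (1 / (B : ℝ)) * (g u + (B - 1) * g v) := by
  obtain ⟨b, rfl⟩ : ∃ b, B = b + 1 := ⟨B - 1, by omega⟩
  have := hg (Fin.cons u fun _ => v) (by intro i; refine Fin.cases ?_ ?_ i <;> simp [hu.1, hu.2, hv.1, hv.2])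
  simpa [Fin.sum_univ_succ] using this

lemma mid (B : ℕ) (hB : 2 ≤ B) (g : ℝ → ℝ) (hm : Measurable g) (hg : ACs B g) (δ : ℝ) (hδ : 0 < δ) :
    ∃ C, ∀ t ∈ Set.Icc δ (1 - δ), g t ≤ C := by
  have hB' : (2 : ℝ) ≤ B := by exact_mod_cast hB
  let S : ℕ → Set ℝ := fun M => Set.Icc 0 1 ∩ {t | (M : ℝ) < g t}
  have hSm : ∀ M, MeasurableSet (S M) := fun M =>
    measurableSet_Icc.inter (measurableSet_lt measurable_const hm)
  have ht : Filter.Tendsto (fun M => MeasureTheory.volume (S M)) Filter.atTop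
      (nhds (MeasureTheory.volume (⋂ M, S M))) := by
    apply MeasureTheory.tendsto_measure_iInter_atTop
    · exact fun M => (hSm M).nullMeasurableSet
    · intro M M' hMM t ht
      have h1 : (M : ℝ) ≤ M' := by exact_mod_cast hMM
      exact ⟨ht.1, lt_of_le_of_lt h1 ht.2⟩
    · refine ⟨0, ne_top_of_le_ne_top ?_ (MeasureTheory.measure_mono Set.inter_subset_left)⟩
      simp
  have he : (⋂ M, S M) = ∅ := by
    ext t
    simp only [Set.mem_iInter, Set.mem_empty_iff_false, iff_false, not_forall]
    obtain ⟨M, hM⟩ := exists_nat_ge (g t)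
    exact ⟨M, fun h => absurd h.2 (not_lt.2 hM)⟩
  rw [he, MeasureTheory.measure_empty] at ht
  have hτ : 0 < δ / B := by positivity
  obtain ⟨M, hM⟩ := (ht.eventually (gt_mem_nhds (ENNReal.ofReal_pos.2 (half_pos hτ)))).exists
  refine ⟨1 + M, fun x hx => ?_⟩
  have h1 : MeasureTheory.volume ((fun t => x - t) ⁻¹' S M) = MeasureTheory.volume (S M) :=
    (MeasureTheory.Measure.measurePreserving_sub_left MeasureTheory.volume x).measure_preimage (hSm M).nullMeasurableSet
  have h2 : MeasureTheory.volume ((fun t => x + (B - 1) * t) ⁻¹' S M) ≤ MeasureTheory.volume (S M) := by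
    have : (fun t : ℝ => x + (B - 1) * t) ⁻¹' S M = (fun t => ((B : ℝ) - 1) * t) ⁻¹' ((fun t => x + t) ⁻¹' S M) := rfl
    rw [this, Real.volume_preimage_mul_left (by linarith), MeasureTheory.measure_preimage_add]
    refine mul_le_of_le_one_left zero_le ?_
    rw [ENNReal.ofReal_le_one, abs_of_nonneg (by rw [inv_nonneg]; linarith)]
    exact inv_le_one_of_one_le₀ (by linarith)
  have hex : ∃ t ∈ Set.Icc 0 (δ / B), t ∉ ((fun t => x - t) ⁻¹' S M) ∪ ((fun t => x + (B - 1) * t) ⁻¹' S M) := by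
    by_contra hcon
    push Not at hcon
    have h3 := MeasureTheory.measure_mono (μ := MeasureTheory.volume) (show Set.Icc 0 (δ / B) ⊆ _ from hcon)
    have h4 := h3.trans (MeasureTheory.measure_union_le _ _)
    rw [h1, Real.volume_Icc] at h4
    have h5 := h4.trans_lt (ENNReal.add_lt_add hM (h2.trans_lt hM))
    rw [← ENNReal.ofReal_add (by positivity) (by positivity)] at h5
    simp at h5
  obtain ⟨t, ht, hnt⟩ := hex
  simp only [Set.mem_union, Set.mem_preimage, not_or] at hnt
  have hBt : B * t ≤ δ := by
    have := ht.2
    rw [le_div_iff₀ (by positivity)] at this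
    linarith
  have ht0 := ht.1
  have hBt0 : t ≤ B * t := by nlinarith
  have hu : x + (B - 1) * t ∈ Set.Icc (0 : ℝ) 1 := by
    constructor <;> nlinarith [hx.1, hx.2]
  have hv : x - t ∈ Set.Icc (0 : ℝ) 1 := by
    constructor <;> nlinarith [hx.1, hx.2]
  have h6 : g (x - t) ≤ M := by by_contra hc; exact hnt.1 ⟨hv, not_le.1 hc⟩
  have h7 : g (x + (B - 1) * t) ≤ M := by by_contra hc; exact hnt.2 ⟨hu, not_le.1 hc⟩
  have h8 := ACs_two B hB g hg _ _ hu hv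
  have h9 : (x + (B - 1) * t + (B - 1) * (x - t)) / B = x := by field_simp; ring
  rw [h9] at h8
  refine h8.trans ?_
  have : g (x + (B - 1) * t) + (B - 1) * g (x - t) ≤ B * M := by nlinarith
  have h10 := mul_le_mul_of_nonneg_left this (show (0 : ℝ) ≤ 1 / B by positivity)
  have h11 : 1 / (B : ℝ) * (B * M) = M := by field_simp
  linarith

lemma left_bd (B : ℕ) (hB : 2 ≤ B) (g : ℝ → ℝ) (hg : ACs B g) (C : ℝ)
    (hC0 : g 0 + 2 ≤ C)
    (hC : ∀ t ∈ Set.Icc (1 / (2 * B) : ℝ) (1 - 1 / (2 * B)), g t ≤ C) :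
    ∀ t ∈ Set.Icc (0 : ℝ) (1 - 1 / (2 * B)), g t ≤ C := by
  have hB' : (2 : ℝ) ≤ B := by exact_mod_cast hB
  have key : ∀ N : ℕ, ∀ t ∈ Set.Ioc (0 : ℝ) (1 - 1 / (2 * B)), 1 / (2 * B) ≤ B ^ N * t → g t ≤ C := by
    intro N
    induction N with
    | zero => intro t ht h; exact hC t ⟨by simpa using h, ht.2⟩
    | succ N ih =>
      intro t ht h
      by_cases htδ : 1 / (2 * B) ≤ t
      · exact hC t ⟨htδ, ht.2⟩
      · push Not at htδ
        have h1 : B * t < 1 / 2 := by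
          calc B * t < B * (1 / (2 * B)) := by gcongr
            _ = 1 / 2 := by field_simp
        have h2 : 1 / (2 * B) ≤ (1 / 4 : ℝ) := by
          apply one_div_le_one_div_of_le <;> linarith
        have h0 := ht.1
        have h3 := ih (B * t) ⟨by positivity, by linarith⟩ (by rw [pow_succ] at h; linarith)
        have h4 := ACs_two B hB g hg (B * t) 0 ⟨by positivity, by linarith⟩ ⟨le_rfl, zero_le_one⟩
        have h5 : (B * t + (B - 1) * 0) / B = t := by field_simp; ring
        rw [h5] at h4
        refine h4.trans ?_
        have : g (B * t) + (B - 1) * g 0 ≤ B * (C - 1) := by nlinarith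
        have h10 := mul_le_mul_of_nonneg_left this (show (0 : ℝ) ≤ 1 / B by positivity)
        have h11 : 1 / (B : ℝ) * (B * (C - 1)) = C - 1 := by field_simp
        linarith
  intro t ht
  rcases ht.1.eq_or_lt with h0 | h0
  · rw [← h0]; linarith
  · obtain ⟨N, hN⟩ := pow_unbounded_of_one_lt (1 / (2 * B) / t) (show (1 : ℝ) < B by linarith)
    refine key N t ⟨h0, ht.2⟩ ?_
    rw [div_lt_iff₀ h0] at hN
    exact hN.le

lemma seg_bd (B : ℕ) (hB : 2 ≤ B) (g : ℝ → ℝ) (hm : Measurable g) (hg : ACs B g) :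
    ∃ C, ∀ t ∈ Set.Icc (0 : ℝ) 1, g t ≤ C := by
  have hB' : (2 : ℝ) ≤ B := by exact_mod_cast hB
  obtain ⟨A, hA⟩ := mid B hB g hm hg (1 / (2 * B)) (by positivity)
  have h2 : 1 / (2 * B) ≤ (1 / 4 : ℝ) := by
    apply one_div_le_one_div_of_le <;> linarith
  refine ⟨max A (max (g 0 + 2) (g 1 + 2)), fun t ht => ?_⟩
  by_cases h : t ≤ 1 - 1 / (2 * B)
  · exact left_bd B hB g hg _ (by simp) (fun s hs => (hA s hs).trans (le_max_left _ _)) t ⟨ht.1, h⟩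
  · push Not at h
    have := left_bd B hB (fun s => g (1 - s)) ?_ (max A (max (g 0 + 2) (g 1 + 2))) (by simp)
      (fun s hs => (hA (1 - s) ⟨by linarith [hs.2], by linarith [hs.1]⟩).trans (le_max_left _ _))
      (1 - t) ⟨by linarith [ht.2], by linarith⟩
    · simpa using this
    · intro y hy
      have := hg (fun i => 1 - y i) (fun i => ⟨by linarith [(hy i).2], by linarith [(hy i).1]⟩)
      convert this using 2
      simp
      field_simp

lemma seg_unif (B : ℕ) (hB : 2 ≤ B) (g : ℝ → ℝ) (hm : Measurable g) (hg : ACs B g) (A : ℝ)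
    (h0 : g 0 ≤ A) (h1 : g 1 ≤ A) : ∀ t ∈ Set.Icc (0 : ℝ) 1, g t ≤ A + 4 := by
  have hB' : (2 : ℝ) ≤ B := by exact_mod_cast hB
  obtain ⟨C, hC⟩ := seg_bd B hB g hm hg
  intro t ht
  have := tree_bound B hB (fun v : Fin 2 → ℝ => g (v 1) - A) ?_ ?_ (C - A) ?_ ![1 - t, t] ?_
  · have h3 := HB_le B hB t
    have h4 := HB_le B hB (1 - t)
    simp [Fin.sum_univ_two] at this
    linarith
  · intro y hy
    have := hg (fun i => y i 1) (fun i => ⟨(hy i).1 1, by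
      have := (hy i).2
      have h3 := (hy i).1 0
      rw [Fin.sum_univ_two] at this; linarith⟩)
    simp only [Finset.sum_sub_distrib, mul_sub]
    simp
    field_simp at this ⊢
    linarith
  · intro k
    fin_cases k <;> simp [h0, h1]
  · intro v hv
    have := hv.2
    have h3 := hv.1 0
    rw [Fin.sum_univ_two] at this
    have := hC (v 1) ⟨hv.1 1, by linarith⟩
    simpa using this
  · refine ⟨fun i => ?_, by simp⟩
    fin_cases i <;> simp [ht.1, ht.2]

lemma simplex_bd {ι : Type} [Fintype ι] [DecidableEq ι] (B : ℕ) (hB : 2 ≤ B) (h : (ι → ℝ) → ℝ)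
    (hm : Measurable h) (hac : ACx B h) (s : Finset ι) :
    ∃ C, ∀ x ∈ stdSimplex ℝ ι, (∀ k, k ∉ s → x k = 0) → h x ≤ C := by
  have hB' : (2 : ℝ) ≤ B := by exact_mod_cast hB
  induction s using Finset.induction_on with
  | empty =>
    refine ⟨0, fun x hx h0 => ?_⟩
    have := hx.2
    simp [h0] at this
  | insert j s hj ih =>
    obtain ⟨C, hC⟩ := ih
    refine ⟨max C (h (Pi.single j 1)) + 4, fun x hx h0 => ?_⟩
    by_cases hxj : 1 ≤ x j
    · rw [eq_single x hx j hxj]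
      linarith [le_max_right C (h (Pi.single j 1))]
    push Not at hxj
    have hpos : 0 < 1 - x j := by linarith
    let w : ι → ℝ := fun k => if k = j then 0 else x k / (1 - x j)
    have hw : w ∈ stdSimplex ℝ ι := by
      refine ⟨fun k => ?_, ?_⟩
      · simp only [w]; split_ifs
        · exact le_rfl
        · exact div_nonneg (hx.1 k) hpos.le
      · have h2 := hx.2
        rw [← Finset.add_sum_erase _ _ (Finset.mem_univ j)] at h2 ⊢
        have : ∑ k ∈ Finset.univ.erase j, w k = ∑ k ∈ Finset.univ.erase j, x k / (1 - x j) :=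
          Finset.sum_congr rfl fun k hk => by simp [w, Finset.ne_of_mem_erase hk]
        rw [this, ← Finset.sum_div]
        have hwj : w j = 0 := by simp [w]
        rw [hwj, zero_add, div_eq_one_iff_eq hpos.ne']
        linarith
    have he : (Pi.single j 1 : ι → ℝ) ∈ stdSimplex ℝ ι := single_mem_stdSimplex ℝ j
    have hwC := hC w hw (fun k hk => by
      simp only [w]; split_ifs with hkj
      · rfl
      · rw [h0 k (by simp [hkj, hk])]; simp)
    let L : ℝ → ι → ℝ := fun t k => (1 - t) * w k + t * (Pi.single j 1 : ι → ℝ) k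
    have hLm : Measurable L := by
      refine measurable_pi_lambda _ fun k => ?_
      simp only [L]; fun_prop
    have hL : ∀ t ∈ Set.Icc (0 : ℝ) 1, L t ∈ stdSimplex ℝ ι := by
      intro t ht
      exact convex_stdSimplex ℝ ι hw he (by linarith [ht.2]) ht.1 (by ring)
    have := seg_unif B hB (fun t => h (L t)) (hm.comp hLm) ?_ (max C (h (Pi.single j 1))) ?_ ?_
      (x j) ⟨hx.1 j, hxj.le⟩
    · have hLx : L (x j) = x := by
        ext k
        by_cases hk : k = j
        · subst hk; simp [L, w]
        · simp [L, w, hk]; field_simp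
      simpa [hLx] using this
    · intro y hy
      have := hac (fun i => L (y i)) (fun i => hL _ (hy i))
      convert this using 2
      ext k
      simp only [L, Finset.sum_add_distrib, ← Finset.sum_mul, Finset.sum_sub_distrib]
      simp
      field_simp
    · have : L 0 = w := by ext k; simp [L]
      simp only [this]
      exact hwC.trans (le_max_left _ _)
    · have : L 1 = Pi.single j 1 := by ext k; simp [L]
      simp only [this]
      exact le_max_right _ _

theorem stmt6 (B n : ℕ) (hB : 2 ≤ B) (hn : 1 ≤ n)
    (h : (Fin (n + 1) → ℝ) → ℝ)
    (hmeas : Measurable fun x : stdSimplex ℝ (Fin (n + 1)) => h x.1)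
    (hac : ∀ y : Fin B → (Fin (n + 1) → ℝ),
      (∀ i, y i ∈ stdSimplex ℝ (Fin (n + 1))) →
      h (fun j => (∑ i, y i j) / (B : ℝ)) ≤ 1 + (1 / (B : ℝ)) * ∑ i, h (y i)) :
    ∀ x ∈ stdSimplex ℝ (Fin (n + 1)),
      h x ≤ (∑ k : Fin (n + 1), HB B (x k)) +
        ∑ k : Fin (n + 1), x k * h (fun j => if j = k then (1 : ℝ) else 0) := by
  classical
  have hB' : (2 : ℝ) ≤ B := by exact_mod_cast hB
  let D := stdSimplex ℝ (Fin (n + 1))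
  have hDm : MeasurableSet D := (isClosed_stdSimplex ℝ (Fin (n + 1))).measurableSet
  let a : Fin (n + 1) → ℝ := fun k => h (Pi.single k 1)
  let f : (Fin (n + 1) → ℝ) → ℝ := fun x => D.indicator h x - ∑ k, x k * a k
  have hind : Measurable (D.indicator h) := by
    refine measurable_of_restrict_of_restrict_compl hDm ?_ ?_
    · convert hmeas using 1
      ext t; exact Set.indicator_of_mem t.2 _
    · convert (measurable_const : Measurable fun _ : (Dᶜ : Set _) => (0 : ℝ)) using 1
      ext t; exact Set.indicator_of_notMem t.2 _
  have hfm : Measurable f := by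
    refine hind.sub ?_
    fun_prop
  have hfD : ∀ x ∈ D, f x = h x - ∑ k, x k * a k := by
    intro x hx
    simp [f, Set.indicator_of_mem hx]
  have hfac : ACx B f := by
    intro y hy
    have hmem : (fun j => (∑ i, y i j) / (B : ℝ)) ∈ D := by
      refine ⟨fun k => div_nonneg (Finset.sum_nonneg fun i _ => (hy i).1 k) (by positivity), ?_⟩
      rw [← Finset.sum_div, Finset.sum_comm, Finset.sum_congr rfl (fun b _ => (hy b).2)]
      have : (B : ℝ) ≠ 0 := by positivity
      simp [this]
    rw [hfD _ hmem, Finset.sum_congr rfl (fun i _ => hfD (y i) (hy i))]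
    have h1 := hac y hy
    have h2 : ∑ k, (∑ i, y i k) / (B : ℝ) * a k = 1 / (B : ℝ) * ∑ i, ∑ k, y i k * a k := by
      rw [Finset.sum_comm, Finset.mul_sum]
      refine Finset.sum_congr rfl fun k _ => ?_
      rw [← Finset.sum_mul]; ring
    rw [Finset.sum_sub_distrib, mul_sub, h2]
    linarith
  obtain ⟨C, hC⟩ := simplex_bd B hB f hfm hfac Finset.univ
  intro x hx
  have key := tree_bound B hB f hfac (fun k => by
    rw [hfD _ (single_mem_stdSimplex ℝ k)]
    simp [Pi.single_apply, a]) C (fun x hx => hC x hx (by simp)) x hx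
  rw [hfD x hx] at key
  have ha : ∀ k, h (fun j => if j = k then (1 : ℝ) else 0) = a k := by
    intro k
    simp only [a]; congr 1; ext j; simp [Pi.single_apply]
  simp only [ha]
  linarith
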